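/- There is a ℤ[q,q⁻¹]-algebra isomorphism O_q(SL_2) ⊗ ℤ[q,q⁻¹][x,x⁻¹] ≅ O_q(GL_2), determined on generators by t_{1,j} ⊗ x^z ↦ D_q⁻¹ t_{1,j} D_q^z and t_{2,j} ⊗ x^z ↦ t_{2,j} D_q^z. -/

import Mathlib

open LaurentPolynomial FreeAlgebra

noncomputable section

/-- The Laurent polynomial ring `ℤ[q,q⁻¹]`. -/
abbrev Rq : Type := LaurentPolynomial ℤ

/-- Defining relations of the 2×2 quantum matrix algebra over a commutative
ring `k`, with quantum parameter `q` and its inverse `qi`; the generators are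
`a = ι 0`, `b = ι 1`, `c = ι 2`, `d = ι 3`. -/
inductive QMRel (k : Type) [CommRing k] (q qi : k) :
    FreeAlgebra k (Fin 4) → FreeAlgebra k (Fin 4) → Prop
  | ab : QMRel k q qi (ι k 0 * ι k 1) (q • (ι k 1 * ι k 0))
  | ac : QMRel k q qi (ι k 0 * ι k 2) (q • (ι k 2 * ι k 0))
  | bd : QMRel k q qi (ι k 1 * ι k 3) (q • (ι k 3 * ι k 1))
  | cd : QMRel k q qi (ι k 2 * ι k 3) (q • (ι k 3 * ι k 2))
  | bc : QMRel k q qi (ι k 1 * ι k 2) (ι k 2 * ι k 1)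
  | ad : QMRel k q qi (ι k 0 * ι k 3)
      (ι k 3 * ι k 0 + (q - qi) • (ι k 1 * ι k 2))

/-- The 2×2 quantum matrix algebra `O_q(M_2)` over `k`. -/
abbrev QM (k : Type) [CommRing k] (q qi : k) := RingQuot (QMRel k q qi)

/-- The four generators of the quantum matrix algebra. -/
def gen (k : Type) [CommRing k] (q qi : k) (i : Fin 4) : QM k q qi :=
  RingQuot.mkAlgHom k (QMRel k q qi) (ι k i)

/-- `O_q(M_2)` over `ℤ[q,q⁻¹]`. -/
abbrev OqM2 : Type := QM Rq (T 1) (T (-1))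
abbrev aq : OqM2 := gen Rq (T 1) (T (-1)) 0
abbrev bq : OqM2 := gen Rq (T 1) (T (-1)) 1
abbrev cq : OqM2 := gen Rq (T 1) (T (-1)) 2
abbrev dq : OqM2 := gen Rq (T 1) (T (-1)) 3

/-- The quantum determinant `D_q = ad - q·bc`. -/
def Dq : OqM2 := aq * dq - (T 1 : Rq) • (bq * cq)

open TensorProduct

/-- The quantum determinant expression `ι 0 * ι 3 - q • (ι 1 * ι 2)` in the
free algebra on 4 generators. -/
def detExpr4 : FreeAlgebra Rq (Fin 4) :=
  ι Rq 0 * ι Rq 3 - (T 1 : Rq) • (ι Rq 1 * ι Rq 2)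

/-- The quantum determinant expression `ι 0 * ι 3 - q • (ι 1 * ι 2)` in the
free algebra on 5 generators. -/
def detExpr5 : FreeAlgebra Rq (Fin 5) :=
  ι Rq 0 * ι Rq 3 - (T 1 : Rq) • (ι Rq 1 * ι Rq 2)

/-- Relations for `O_q(SL_2)`: the quantum matrix relations plus `D_q = 1`. -/
inductive SLRel : FreeAlgebra Rq (Fin 4) → FreeAlgebra Rq (Fin 4) → Prop
  | ab : SLRel (ι Rq 0 * ι Rq 1) ((T 1 : Rq) • (ι Rq 1 * ι Rq 0))
  | ac : SLRel (ι Rq 0 * ι Rq 2) ((T 1 : Rq) • (ι Rq 2 * ι Rq 0))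
  | bd : SLRel (ι Rq 1 * ι Rq 3) ((T 1 : Rq) • (ι Rq 3 * ι Rq 1))
  | cd : SLRel (ι Rq 2 * ι Rq 3) ((T 1 : Rq) • (ι Rq 3 * ι Rq 2))
  | bc : SLRel (ι Rq 1 * ι Rq 2) (ι Rq 2 * ι Rq 1)
  | ad : SLRel (ι Rq 0 * ι Rq 3)
      (ι Rq 3 * ι Rq 0 + ((T 1 : Rq) - (T (-1) : Rq)) • (ι Rq 1 * ι Rq 2))
  | det : SLRel (detExpr4) 1

/-- Relations for `O_q(GL_2)`: the quantum matrix relations on the first four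
generators, plus a fifth generator which is a two-sided inverse of `D_q`. -/
inductive GLRel : FreeAlgebra Rq (Fin 5) → FreeAlgebra Rq (Fin 5) → Prop
  | ab : GLRel (ι Rq 0 * ι Rq 1) ((T 1 : Rq) • (ι Rq 1 * ι Rq 0))
  | ac : GLRel (ι Rq 0 * ι Rq 2) ((T 1 : Rq) • (ι Rq 2 * ι Rq 0))
  | bd : GLRel (ι Rq 1 * ι Rq 3) ((T 1 : Rq) • (ι Rq 3 * ι Rq 1))
  | cd : GLRel (ι Rq 2 * ι Rq 3) ((T 1 : Rq) • (ι Rq 3 * ι Rq 2))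
  | bc : GLRel (ι Rq 1 * ι Rq 2) (ι Rq 2 * ι Rq 1)
  | ad : GLRel (ι Rq 0 * ι Rq 3)
      (ι Rq 3 * ι Rq 0 + ((T 1 : Rq) - (T (-1) : Rq)) • (ι Rq 1 * ι Rq 2))
  | invR : GLRel (detExpr5 * ι Rq 4) 1
  | invL : GLRel (ι Rq 4 * detExpr5) 1

/-- `O_q(SL_2) = O_q(M_2)/(D_q - 1)`. -/
abbrev OqSL2 : Type := RingQuot SLRel
/-- `O_q(GL_2) = O_q(M_2)[D_q⁻¹]`. -/
abbrev OqGL2 : Type := RingQuot GLRel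

def slGen (i : Fin 4) : OqSL2 := RingQuot.mkAlgHom Rq SLRel (ι Rq i)
def glGen (i : Fin 5) : OqGL2 := RingQuot.mkAlgHom Rq GLRel (ι Rq i)

/-- `D_q` inside `O_q(GL_2)`. -/
def Dgl : OqGL2 := glGen 0 * glGen 3 - (T 1 : Rq) • (glGen 1 * glGen 2)

/-- The quantum determinant commutes with the four generators, in any algebra. -/
theorem qdet_comm {k A : Type} [CommRing k] [Ring A] [Algebra k A] (q qi : k) (hq : q * qi = 1)
    (a b c d : A) (ab : a * b = q • (b * a)) (ac : a * c = q • (c * a))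
    (bd : b * d = q • (d * b)) (cd : c * d = q • (d * c)) (bc : b * c = c * b)
    (ad : a * d = d * a + (q - qi) • (b * c)) :
    Commute (a * d - q • (b * c)) a ∧ Commute (a * d - q • (b * c)) b ∧
    Commute (a * d - q • (b * c)) c ∧ Commute (a * d - q • (b * c)) d := by
  have hq' : qi * q = 1 := by rw [mul_comm, hq]
  have abc : a * (b * c) = (q * q) • (b * c * a) := by
    rw [← mul_assoc, ab, smul_mul_assoc, mul_assoc, ac, mul_smul_comm, smul_smul, mul_assoc]
  have bcd : b * c * d = (q * q) • (d * (b * c)) := by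
    rw [mul_assoc, cd, mul_smul_comm, ← mul_assoc, bd, smul_mul_assoc, smul_smul, mul_assoc]
  have had : a * d - q • (b * c) = d * a - qi • (b * c) := by
    rw [ad, sub_smul]; abel
  refine ⟨?_, ?_, ?_, ?_⟩
  · change _ * _ = _ * _
    conv_rhs => rw [had]
    rw [sub_mul, mul_sub, mul_smul_comm, abc, smul_smul, ← mul_assoc qi, hq', one_mul,
      smul_mul_assoc, mul_assoc]
  · change _ * _ = _ * _
    have h1 : b * (a * d) = a * d * b := by
      have : q • (b * (a * d)) = q • (a * d * b) := by
        rw [← mul_assoc, ← smul_mul_assoc, ← ab, mul_assoc, bd, mul_smul_comm, mul_assoc]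
      simpa [smul_smul, hq'] using congrArg (qi • ·) this
    rw [sub_mul, mul_sub, h1, mul_smul_comm, smul_mul_assoc, mul_assoc b c b, bc]
  · change _ * _ = _ * _
    have h1 : c * (a * d) = a * d * c := by
      have : q • (c * (a * d)) = q • (a * d * c) := by
        rw [← mul_assoc, ← smul_mul_assoc, ← ac, mul_assoc, cd, mul_smul_comm, mul_assoc]
      simpa [smul_smul, hq'] using congrArg (qi • ·) this
    rw [sub_mul, mul_sub, h1, mul_smul_comm, smul_mul_assoc, ← mul_assoc c b c, bc]
  · change _ * _ = _ * _
    conv_lhs => rw [had]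
    rw [sub_mul, mul_sub, mul_smul_comm, smul_mul_assoc, bcd, smul_smul, ← mul_assoc qi, hq',
      one_mul, mul_assoc]

theorem T_mul_inv : (T 1 : Rq) * T (-1) = 1 := by
  rw [← T_add]; simp

theorem gl_ab : glGen 0 * glGen 1 = (T 1 : Rq) • (glGen 1 * glGen 0) := by
  simpa [glGen] using RingQuot.mkAlgHom_rel Rq GLRel.ab
theorem gl_ac : glGen 0 * glGen 2 = (T 1 : Rq) • (glGen 2 * glGen 0) := by
  simpa [glGen] using RingQuot.mkAlgHom_rel Rq GLRel.ac
theorem gl_bd : glGen 1 * glGen 3 = (T 1 : Rq) • (glGen 3 * glGen 1) := by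
  simpa [glGen] using RingQuot.mkAlgHom_rel Rq GLRel.bd
theorem gl_cd : glGen 2 * glGen 3 = (T 1 : Rq) • (glGen 3 * glGen 2) := by
  simpa [glGen] using RingQuot.mkAlgHom_rel Rq GLRel.cd
theorem gl_bc : glGen 1 * glGen 2 = glGen 2 * glGen 1 := by
  simpa [glGen] using RingQuot.mkAlgHom_rel Rq GLRel.bc
theorem gl_ad : glGen 0 * glGen 3 =
    glGen 3 * glGen 0 + ((T 1 : Rq) - (T (-1) : Rq)) • (glGen 1 * glGen 2) := by
  simpa [glGen] using RingQuot.mkAlgHom_rel Rq GLRel.ad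
theorem gl_invR : Dgl * glGen 4 = 1 := by
  simpa [glGen, Dgl, detExpr5] using RingQuot.mkAlgHom_rel Rq GLRel.invR
theorem gl_invL : glGen 4 * Dgl = 1 := by
  simpa [glGen, Dgl, detExpr5] using RingQuot.mkAlgHom_rel Rq GLRel.invL

theorem sl_ab : slGen 0 * slGen 1 = (T 1 : Rq) • (slGen 1 * slGen 0) := by
  simpa [slGen] using RingQuot.mkAlgHom_rel Rq SLRel.ab
theorem sl_ac : slGen 0 * slGen 2 = (T 1 : Rq) • (slGen 2 * slGen 0) := by
  simpa [slGen] using RingQuot.mkAlgHom_rel Rq SLRel.ac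
theorem sl_bd : slGen 1 * slGen 3 = (T 1 : Rq) • (slGen 3 * slGen 1) := by
  simpa [slGen] using RingQuot.mkAlgHom_rel Rq SLRel.bd
theorem sl_cd : slGen 2 * slGen 3 = (T 1 : Rq) • (slGen 3 * slGen 2) := by
  simpa [slGen] using RingQuot.mkAlgHom_rel Rq SLRel.cd
theorem sl_bc : slGen 1 * slGen 2 = slGen 2 * slGen 1 := by
  simpa [slGen] using RingQuot.mkAlgHom_rel Rq SLRel.bc
theorem sl_ad : slGen 0 * slGen 3 =
    slGen 3 * slGen 0 + ((T 1 : Rq) - (T (-1) : Rq)) • (slGen 1 * slGen 2) := by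
  simpa [slGen] using RingQuot.mkAlgHom_rel Rq SLRel.ad
theorem sl_det : slGen 0 * slGen 3 - (T 1 : Rq) • (slGen 1 * slGen 2) = 1 := by
  simpa [slGen, detExpr4] using RingQuot.mkAlgHom_rel Rq SLRel.det

/-- `D_q` as a unit. -/
def Du : OqGL2ˣ := ⟨Dgl, glGen 4, gl_invR, gl_invL⟩

theorem Du_val : (Du : OqGL2) = Dgl := rfl
theorem Du_inv : ((Du⁻¹ : OqGL2ˣ) : OqGL2) = glGen 4 := rfl

theorem Dgl_comm (i : Fin 4) : Commute Dgl (glGen i.castSucc) := by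
  have h := qdet_comm (k := Rq) (A := OqGL2) (T 1 : Rq) (T (-1)) T_mul_inv (glGen 0) (glGen 1)
    (glGen 2) (glGen 3) gl_ab gl_ac gl_bd gl_cd gl_bc gl_ad
  fin_cases i
  · exact h.1
  · exact h.2.1
  · exact h.2.2.1
  · exact h.2.2.2

theorem E_comm (i : Fin 4) : Commute (glGen 4) (glGen i.castSucc) := by
  have h : Commute (Du : OqGL2) (glGen i.castSucc) := Dgl_comm i
  exact h.units_inv_left

theorem E_comm0 : glGen 0 * glGen 4 = glGen 4 * glGen 0 := (E_comm 0).eq.symm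
theorem E_comm1 : glGen 1 * glGen 4 = glGen 4 * glGen 1 := (E_comm 1).eq.symm
theorem E_comm2 : glGen 2 * glGen 4 = glGen 4 * glGen 2 := (E_comm 2).eq.symm
theorem E_comm3 : glGen 3 * glGen 4 = glGen 4 * glGen 3 := (E_comm 3).eq.symm

/-- Images of the generators of `O_q(SL_2)`. -/
def slImg (i : Fin 4) : OqGL2 :=
  (if (i : ℕ) < 2 then glGen 4 else 1) * glGen (Fin.castSucc i)

theorem slImg0 : slImg 0 = glGen 4 * glGen 0 := by simp [slImg]
theorem slImg1 : slImg 1 = glGen 4 * glGen 1 := by simp [slImg]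
theorem slImg2 : slImg 2 = glGen 2 := by simp [slImg]
theorem slImg3 : slImg 3 = glGen 3 := by simp [slImg]

theorem slImg_rel ⦃x y : FreeAlgebra Rq (Fin 4)⦄ (h : SLRel x y) :
    FreeAlgebra.lift Rq slImg x = FreeAlgebra.lift Rq slImg y := by
  have e0 (z : OqGL2) : glGen 0 * (glGen 4 * z) = glGen 4 * (glGen 0 * z) := by
    rw [← mul_assoc, E_comm0, mul_assoc]
  have e1 (z : OqGL2) : glGen 1 * (glGen 4 * z) = glGen 4 * (glGen 1 * z) := by
    rw [← mul_assoc, E_comm1, mul_assoc]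
  have e2 (z : OqGL2) : glGen 2 * (glGen 4 * z) = glGen 4 * (glGen 2 * z) := by
    rw [← mul_assoc, E_comm2, mul_assoc]
  have e3 (z : OqGL2) : glGen 3 * (glGen 4 * z) = glGen 4 * (glGen 3 * z) := by
    rw [← mul_assoc, E_comm3, mul_assoc]
  cases h <;> simp only [map_mul, map_smul, map_add, map_sub, map_one, detExpr4,
    FreeAlgebra.lift_ι_apply, slImg0, slImg1, slImg2, slImg3, mul_assoc, e0, e1, e2, e3]
  · rw [gl_ab]; simp only [mul_smul_comm]
  · rw [gl_ac]; simp only [mul_smul_comm]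
  · rw [gl_bd]; simp only [mul_smul_comm]
  · rw [gl_cd]
  · rw [gl_bc]
  · rw [gl_ad]; simp only [mul_smul_comm, mul_add]
  · rw [← mul_smul_comm]; exact (mul_sub (glGen 4) (glGen 0 * glGen 3)
      ((T 1 : Rq) • (glGen 1 * glGen 2))).symm.trans gl_invL

/-- The map `O_q(SL_2) → O_q(GL_2)`. -/
def slHom : OqSL2 →ₐ[Rq] OqGL2 := RingQuot.liftAlgHom Rq ⟨FreeAlgebra.lift Rq slImg, slImg_rel⟩

theorem slHom_gen (i : Fin 4) : slHom (slGen i) = slImg i := by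
  rw [slHom, slGen, RingQuot.liftAlgHom_mkAlgHom_apply, FreeAlgebra.lift_ι_apply]

/-- The map `x ↦ D_q`. -/
def lauHom : LaurentPolynomial Rq →ₐ[Rq] OqGL2 :=
  AddMonoidAlgebra.lift Rq OqGL2 ℤ ((Units.coeHom OqGL2).comp (zpowersHom OqGL2ˣ Du))

theorem lauHom_T (z : ℤ) : lauHom (T z) = ((Du ^ z : OqGL2ˣ) : OqGL2) := by
  rw [lauHom, T, AddMonoidAlgebra.lift_single]
  simp

theorem slHom_comm (x : OqSL2) : Commute (Du : OqGL2) (slHom x) := by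
  obtain ⟨x, rfl⟩ := RingQuot.mkAlgHom_surjective Rq SLRel x
  induction x using FreeAlgebra.induction with
  | grade0 r => rw [AlgHom.commutes, AlgHom.commutes]; exact Algebra.commute_algebraMap_right _ _
  | grade1 i =>
    change Commute _ (slHom (slGen i))
    rw [slHom_gen, slImg]
    refine Commute.mul_right ?_ (Dgl_comm i)
    split_ifs
    · exact gl_invR.trans gl_invL.symm
    · exact Commute.one_right _
  | mul a b ha hb => rw [map_mul, map_mul]; exact ha.mul_right hb
  | add a b ha hb => rw [map_add, map_add]; exact ha.add_right hb

theorem hom_comm (x : OqSL2) (y : LaurentPolynomial Rq) : Commute (slHom x) (lauHom y) := by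
  induction y using LaurentPolynomial.induction_on' with
  | add p q hp hq => rw [map_add]; exact hp.add_right hq
  | C_mul_T n a =>
    rw [map_mul, lauHom_T]
    refine Commute.mul_right ?_ ((slHom_comm x).units_zpow_left n).symm
    have : (C a : LaurentPolynomial Rq) = algebraMap Rq _ a := rfl
    rw [this, AlgHom.commutes]
    exact Algebra.commute_algebraMap_right _ _

/-- The forward map. -/
def fwd : (OqSL2 ⊗[Rq] LaurentPolynomial Rq) →ₐ[Rq] OqGL2 :=
  Algebra.TensorProduct.lift slHom lauHom hom_comm

theorem fwd_tmul (x : OqSL2) (y : LaurentPolynomial Rq) :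
    fwd (x ⊗ₜ y) = slHom x * lauHom y := rfl

/-- Images of the generators of `O_q(GL_2)`. -/
def glImg : Fin 5 → OqSL2 ⊗[Rq] LaurentPolynomial Rq :=
  ![slGen 0 ⊗ₜ T 1, slGen 1 ⊗ₜ T 1, slGen 2 ⊗ₜ 1, slGen 3 ⊗ₜ 1, 1 ⊗ₜ T (-1)]

theorem glImg0 : glImg 0 = slGen 0 ⊗ₜ T 1 := rfl
theorem glImg1 : glImg 1 = slGen 1 ⊗ₜ T 1 := rfl
theorem glImg2 : glImg 2 = slGen 2 ⊗ₜ 1 := rfl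
theorem glImg3 : glImg 3 = slGen 3 ⊗ₜ 1 := rfl
theorem glImg4 : glImg 4 = 1 ⊗ₜ T (-1) := rfl

theorem module_cancel {M : Type} [AddCommMonoid M] [Module Rq M] {x y z : M}
    (h : x + y = z + y) : x = z := by
  letI := Module.addCommMonoidToAddCommGroup Rq (M := M)
  exact add_right_cancel h

theorem sl_det_add : 1 + (T 1 : Rq) • (slGen 1 * slGen 2) = slGen 0 * slGen 3 := by
  rw [← sl_det]
  exact sub_add_cancel (slGen 0 * slGen 3) ((T 1 : Rq) • (slGen 1 * slGen 2))

theorem glImg_det : FreeAlgebra.lift Rq glImg detExpr5 = 1 ⊗ₜ T 1 := by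
  have h : detExpr5 + (T 1 : Rq) • (ι Rq 1 * ι Rq 2) = ι Rq 0 * ι Rq 3 :=
    sub_add_cancel (ι Rq 0 * ι Rq 3) ((T 1 : Rq) • (ι Rq 1 * ι Rq 2))
  have h2 := congrArg (FreeAlgebra.lift Rq glImg) h
  simp only [map_add, map_mul, map_smul, FreeAlgebra.lift_ι_apply, glImg0, glImg1, glImg2, glImg3,
    Algebra.TensorProduct.tmul_mul_tmul, mul_one, TensorProduct.smul_tmul', ← sl_det_add,
    TensorProduct.add_tmul] at h2
  exact module_cancel h2

theorem glImg_rel ⦃x y : FreeAlgebra Rq (Fin 5)⦄ (h : GLRel x y) :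
    FreeAlgebra.lift Rq glImg x = FreeAlgebra.lift Rq glImg y := by
  cases h <;> simp only [map_mul, map_smul, map_add, map_one, glImg_det,
    FreeAlgebra.lift_ι_apply, glImg0, glImg1, glImg2, glImg3, glImg4,
    Algebra.TensorProduct.tmul_mul_tmul, mul_one, one_mul, TensorProduct.smul_tmul',
    ← TensorProduct.add_tmul]
  · rw [sl_ab]
  · rw [sl_ac]
  · rw [sl_bd]
  · rw [sl_cd]
  · rw [sl_bc]
  · rw [sl_ad]
  · rw [← T_add]; rfl
  · rw [← T_add]; rfl

/-- The inverse map. -/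
def bwd : OqGL2 →ₐ[Rq] (OqSL2 ⊗[Rq] LaurentPolynomial Rq) :=
  RingQuot.liftAlgHom Rq ⟨FreeAlgebra.lift Rq glImg, glImg_rel⟩

theorem bwd_gen (i : Fin 5) : bwd (glGen i) = glImg i := by
  rw [bwd, glGen, RingQuot.liftAlgHom_mkAlgHom_apply, FreeAlgebra.lift_ι_apply]

theorem bwd_D : bwd (Du : OqGL2) = 1 ⊗ₜ T 1 := by
  have h : Dgl + (T 1 : Rq) • (glGen 1 * glGen 2) = glGen 0 * glGen 3 :=
    sub_add_cancel (glGen 0 * glGen 3) ((T 1 : Rq) • (glGen 1 * glGen 2))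
  have h2 := congrArg bwd h
  simp only [map_add, map_mul, map_smul, bwd_gen, glImg0, glImg1, glImg2, glImg3,
    Algebra.TensorProduct.tmul_mul_tmul, mul_one, TensorProduct.smul_tmul', ← sl_det_add,
    TensorProduct.add_tmul] at h2
  exact module_cancel h2

theorem bwd_Dz (z : ℤ) : bwd ((Du ^ z : OqGL2ˣ) : OqGL2) = 1 ⊗ₜ T z := by
  have hn (n : ℕ) : bwd ((Du ^ n : OqGL2ˣ) : OqGL2) = 1 ⊗ₜ T n := by
    rw [Units.val_pow_eq_pow_val, map_pow, bwd_D, Algebra.TensorProduct.tmul_pow, one_pow, T_pow,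
      mul_one]
  have hm (n : ℕ) : bwd (((Du⁻¹) ^ n : OqGL2ˣ) : OqGL2) = 1 ⊗ₜ T (-n) := by
    rw [Units.val_pow_eq_pow_val, map_pow, Du_inv, bwd_gen, glImg4,
      Algebra.TensorProduct.tmul_pow, one_pow, T_pow, mul_neg, mul_one]
  obtain ⟨n, rfl | rfl⟩ := z.eq_nat_or_neg
  · rw [zpow_natCast]; exact hn n
  · rw [zpow_neg, zpow_natCast, ← inv_pow]; exact hm n

theorem fwd_bwd : fwd.comp bwd = AlgHom.id Rq OqGL2 := by
  apply RingQuot.ringQuot_ext'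
  apply FreeAlgebra.hom_ext
  funext i
  change fwd (bwd (glGen i)) = glGen i
  rw [bwd_gen]
  have key (i : Fin 4) (h : Commute Dgl (glGen i.castSucc)) :
      glGen 4 * glGen i.castSucc * Dgl = glGen i.castSucc := by
    rw [mul_assoc, ← h.eq, ← mul_assoc, gl_invL, one_mul]
  fin_cases i
  · change fwd (slGen 0 ⊗ₜ T 1) = glGen 0
    rw [fwd_tmul, slHom_gen, lauHom_T, slImg0, zpow_one]
    exact key 0 (Dgl_comm 0)
  · change fwd (slGen 1 ⊗ₜ T 1) = glGen 1
    rw [fwd_tmul, slHom_gen, lauHom_T, slImg1, zpow_one]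
    exact key 1 (Dgl_comm 1)
  · change fwd (slGen 2 ⊗ₜ 1) = glGen 2
    rw [fwd_tmul, slHom_gen, slImg2, map_one, mul_one]
  · change fwd (slGen 3 ⊗ₜ 1) = glGen 3
    rw [fwd_tmul, slHom_gen, slImg3, map_one, mul_one]
  · change fwd (1 ⊗ₜ T (-1)) = glGen 4
    rw [fwd_tmul, map_one, lauHom_T, one_mul, zpow_neg_one, Du_inv]

theorem bwd_slHom : bwd.comp slHom = Algebra.TensorProduct.includeLeft := by
  apply RingQuot.ringQuot_ext'
  apply FreeAlgebra.hom_ext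
  funext i
  change bwd (slHom (slGen i)) = slGen i ⊗ₜ 1
  rw [slHom_gen]
  have hT : (T (-1) * T 1 : LaurentPolynomial Rq) = 1 := by rw [← T_add]; rfl
  fin_cases i
  · change bwd (slImg 0) = slGen 0 ⊗ₜ 1
    rw [slImg0, map_mul, bwd_gen, bwd_gen, glImg4, glImg0, Algebra.TensorProduct.tmul_mul_tmul,
      one_mul, hT]
  · change bwd (slImg 1) = slGen 1 ⊗ₜ 1
    rw [slImg1, map_mul, bwd_gen, bwd_gen, glImg4, glImg1, Algebra.TensorProduct.tmul_mul_tmul,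
      one_mul, hT]
  · change bwd (slImg 2) = slGen 2 ⊗ₜ 1
    rw [slImg2, bwd_gen, glImg2]
  · change bwd (slImg 3) = slGen 3 ⊗ₜ 1
    rw [slImg3, bwd_gen, glImg3]

theorem bwd_lauHom (y : LaurentPolynomial Rq) : bwd (lauHom y) = 1 ⊗ₜ y := by
  induction y using LaurentPolynomial.induction_on' with
  | add p q hp hq => rw [map_add, map_add, hp, hq, TensorProduct.tmul_add]
  | C_mul_T n a =>
    have : (C a * T n : LaurentPolynomial Rq) = a • T n := by
      rw [Algebra.smul_def]; rfl
    rw [this, map_smul, map_smul, lauHom_T, bwd_Dz, TensorProduct.tmul_smul]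

theorem bwd_fwd : bwd.comp fwd = AlgHom.id Rq (OqSL2 ⊗[Rq] LaurentPolynomial Rq) := by
  apply Algebra.TensorProduct.ext'
  intro x y
  change bwd (fwd (x ⊗ₜ y)) = x ⊗ₜ y
  have hx : bwd (slHom x) = x ⊗ₜ 1 := AlgHom.congr_fun bwd_slHom x
  rw [fwd_tmul, map_mul, hx, bwd_lauHom, Algebra.TensorProduct.tmul_mul_tmul, mul_one, one_mul]

/-- There is a `ℤ[q,q⁻¹]`-algebra isomorphism
`O_q(SL_2) ⊗ ℤ[q,q⁻¹][x,x⁻¹] ≅ O_q(GL_2)`, sending `t_{1,j} ⊗ x^z` to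
`D_q⁻¹ t_{1,j} D_q^z` and `t_{2,j} ⊗ x^z` to `t_{2,j} D_q^z`. -/
theorem SL2_tensor_laurent_iso_GL2 :
    ∃ (u : OqGL2ˣ) (f : (OqSL2 ⊗[Rq] LaurentPolynomial Rq) ≃ₐ[Rq] OqGL2),
      (u : OqGL2) = Dgl ∧
      ∀ (i : Fin 4) (z : ℤ),
        f (slGen i ⊗ₜ[Rq] (T z : LaurentPolynomial Rq)) =
          (if (i : ℕ) < 2 then ((u⁻¹ : OqGL2ˣ) : OqGL2) else 1) *
            glGen (Fin.castSucc i) * ((u ^ z : OqGL2ˣ) : OqGL2) := by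
  refine ⟨Du, AlgEquiv.ofAlgHom fwd bwd fwd_bwd bwd_fwd, Du_val, fun i z => ?_⟩
  change fwd (slGen i ⊗ₜ T z) = _
  rw [fwd_tmul, slHom_gen, lauHom_T, slImg, Du_inv]
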